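/- Let (g,[.,.]_g,α,[p]) be a restricted Hom-Lie algebra over a field F of prime characteristic p and let L ⊆ g be a finite-dimensional Hom-Lie subalgebra whose α^{p-1}-center is zero, i.e., C(L) = {x ∈ L | [x,α^{p-1}(y)] = 0 for all y ∈ L} = {0}. Suppose λ : g × g → F is a symmetric bilinear form that is associative, i.e., λ(x,[y,z]) = λ([x,α^{p-1}(y)],z) for all x,y,z ∈ g, and whose restriction to L × L is nondegenerate, i.e., {x ∈ L | λ(x,y) = 0 for all y ∈ L} = {0}. Then the multiplicative Hom-Lie algebra (L,[.,.]_g,α|_L) is restrictable. -/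

import Mathlib

namespace HomLiePaper

/-- The axioms of a Hom-Lie algebra over a field `F`: the bracket is bilinear and
skew-symmetric, the twist `α` is linear, and the Hom-Jacobi identity holds. -/
structure IsHomLie (F : Type*) {L : Type*} [Field F] [AddCommGroup L] [Module F L]
    (br : L → L → L) (α : L → L) : Prop where
  add_left : ∀ x y z : L, br (x + y) z = br x z + br y z
  smul_left : ∀ (k : F) (x y : L), br (k • x) y = k • br x y
  add_right : ∀ x y z : L, br x (y + z) = br x y + br x z
  smul_right : ∀ (k : F) (x y : L), br x (k • y) = k • br x y
  skew : ∀ x y : L, br x y = - br y x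
  alpha_linear : IsLinearMap F α
  jacobi : ∀ x y z : L, br (α x) (br y z) + br (α y) (br z x) + br (α z) (br x y) = 0

/-- Multiplicativity of the twist `α`. -/
def IsMult {L : Type*} (br : L → L → L) (α : L → L) : Prop :=
  ∀ x y : L, α (br x y) = br (α x) (α y)

/-- `adPow br α x n = ad(α^[n-1] x) ∘ ad(α^[n-2] x) ∘ ⋯ ∘ ad(x)` (with `n` factors). -/
def adPow {L : Type*} (br : L → L → L) (α : L → L) (x : L) : ℕ → L → L
  | 0 => fun z => z
  | n + 1 => fun z => br (α^[n] x) (adPow br α x n z)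

/-- `pm` is a `p`-structure on the Hom-Lie (sub)algebra carried by the subset `S` of `L`
(for the whole algebra take `S = Set.univ`): `pm` maps `S` into itself and satisfies
(R1) `ad(x^[p]) ∘ α^(p-1) = ad(α^(p-1) x) ∘ ⋯ ∘ ad(x)` on `S`,
(R2) `(k • x)^[p] = k^p • x^[p]`, and
(R3) `(x+y)^[p] = x^[p] + y^[p] + ∑_{i=1}^{p-1} s_i(x,y)` where the `s_i(x,y)` are
determined by `ad(α^(p-2)(k•x+y)) ∘ ⋯ ∘ ad(k•x+y) (x) = ∑_{i=1}^{p-1} i k^(i-1) • s_i(x,y)`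
for all `k : F`. -/
def IsPStructureOn (F : Type*) {L : Type*} [Field F] [AddCommGroup L] [Module F L]
    (p : ℕ) (br : L → L → L) (α : L → L) (S : Set L) (pm : L → L) : Prop :=
  (∀ x ∈ S, pm x ∈ S) ∧
  (∀ x ∈ S, ∀ y ∈ S, br (pm x) (α^[p - 1] y) = adPow br α x p y) ∧
  (∀ x ∈ S, ∀ k : F, pm (k • x) = k ^ p • pm x) ∧
  (∀ x ∈ S, ∀ y ∈ S, ∃ s : ℕ → L,
    (∀ i ∈ Finset.Icc 1 (p - 1), s i ∈ S) ∧
    (∀ k : F, adPow br α (k • x + y) (p - 1) x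
        = ∑ i ∈ Finset.Icc 1 (p - 1), ((i : F) * k ^ (i - 1)) • s i) ∧
    pm (x + y) = pm x + pm y + ∑ i ∈ Finset.Icc 1 (p - 1), s i)

/-- The Hom-Lie (sub)algebra carried by `S ⊆ L` is restrictable: for every `x ∈ S` there is
`y ∈ S` with `ad(α^(p-1) x) ∘ ⋯ ∘ ad(x) = ad(y) ∘ α^(p-1)` as operators on `S`. -/
def RestrictableOn {L : Type*} (p : ℕ) (br : L → L → L) (α : L → L) (S : Set L) : Prop :=
  ∀ x ∈ S, ∃ y ∈ S, ∀ z ∈ S, adPow br α x p z = br y (α^[p - 1] z)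

theorem adPow_mem {L : Type*} {br : L → L → L} {α : L → L} {S : Set L}
    (hα : ∀ x ∈ S, α x ∈ S) (hbr : ∀ x ∈ S, ∀ y ∈ S, br x y ∈ S)
    {x z : L} (hx : x ∈ S) (hz : z ∈ S) (n : ℕ) : adPow br α x n z ∈ S := by
  induction n with
  | zero => exact hz
  | succ n ih => exact hbr _ (Set.MapsTo.iterate (f := α) hα n hx) _ ih

/-- If a bilinear form is nondegenerate on a finite-dimensional subspace `L`, then every
element of the ambient space pairs with `L` in the same way as some element of `L`. -/
theorem exists_mem_forall_apply_eq {F V : Type*} [Field F] [AddCommGroup V] [Module F V]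
    (B : V →ₗ[F] V →ₗ[F] F) (L : Submodule F V) [FiniteDimensional F L]
    (hB : ∀ x ∈ L, (∀ y ∈ L, B x y = 0) → x = 0) (u : V) :
    ∃ y ∈ L, ∀ z ∈ L, B y z = B u z := by
  let T : L →ₗ[F] Module.Dual F L := B.domRestrict₁₂ L L
  have hinj : Function.Injective T := by
    refine (injective_iff_map_eq_zero T).2 fun x hx => Subtype.ext ?_
    exact hB x x.2 fun y hy => LinearMap.congr_fun hx ⟨y, hy⟩
  have hsurj : Function.Surjective T :=
    (LinearMap.injective_iff_surjective_of_finrank_eq_finrank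
      Subspace.dual_finrank_eq.symm).1 hinj
  obtain ⟨y, hy⟩ := hsurj ((B u).domRestrict L)
  exact ⟨y, y.2, fun z hz => LinearMap.congr_fun hy ⟨z, hz⟩⟩

/-- Let `(g, br, α, pm)` be a restricted Hom-Lie algebra and `L ⊆ g` a finite-dimensional
Hom-Lie subalgebra with trivial `α^(p-1)`-center. If `lam : g × g → F` is an associative
symmetric bilinear form whose restriction to `L × L` is nondegenerate, then `L` is
restrictable. -/
theorem restrictable_of_nondegenerate_form {F g : Type*} [Field F]
    [AddCommGroup g] [Module F g]
    (p : ℕ) (hp : p.Prime) [CharP F p]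
    (br : g → g → g) (α : g → g) (pm : g → g)
    (hHL : IsHomLie F br α) (hM : IsMult br α)
    (hps : IsPStructureOn F p br α Set.univ pm)
    (L : Submodule F g) [FiniteDimensional F L]
    (hLα : ∀ x ∈ L, α x ∈ L) (hLbr : ∀ x ∈ L, ∀ y ∈ L, br x y ∈ L)
    (hC : ∀ x ∈ L, (∀ y ∈ L, br x (α^[p - 1] y) = 0) → x = 0)
    (lam : g → g → F)
    (hadd : ∀ x y z : g, lam (x + y) z = lam x z + lam y z)
    (hsmul : ∀ (k : F) (x y : g), lam (k • x) y = k * lam x y)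
    (hsymm : ∀ x y : g, lam x y = lam y x)
    (hassoc : ∀ x y z : g, lam x (br y z) = lam (br x (α^[p - 1] y)) z)
    (hnondeg : ∀ x ∈ L, (∀ y ∈ L, lam x y = 0) → x = 0) :
    RestrictableOn p br α (L : Set g) := by
  obtain ⟨-, hR1, -, -⟩ := hps
  let B : g →ₗ[F] g →ₗ[F] F := LinearMap.mk₂ F lam hadd hsmul
    (fun x y z => by rw [hsymm, hadd, hsymm y, hsymm z])
    (fun k x y => by rw [hsymm, hsmul, hsymm y, smul_eq_mul])
  intro x hx
  obtain ⟨y, hy, hyu⟩ := exists_mem_forall_apply_eq B L hnondeg (pm x)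
  refine ⟨y, hy, fun z hz => sub_eq_zero.1 (hnondeg _ (L.sub_mem ?_ ?_) fun w hw => ?_)⟩
  · exact adPow_mem (S := (L : Set g)) hLα hLbr hx hz p
  · exact hLbr _ hy _ (Set.MapsTo.iterate (f := α) (s := (L : Set g)) hLα _ hz)
  · rw [← hR1 x trivial z trivial]
    change B _ w = 0
    rw [map_sub, LinearMap.sub_apply, sub_eq_zero]
    change lam _ w = lam _ w
    rw [← hassoc, ← hassoc]
    exact (hyu _ (hLbr _ hz _ hw)).symm
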